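/- Let Y = 𝔻∖{0} be the punctured unit disk and Ω = ℂ∖{0} the punctured plane. Then the generalized Hurwitz density of Ω with basepoint domain Y coincides with the Hurwitz density of Ω: η_{ℂ∖{0}}^{𝔻∖{0}}(w) = η_{ℂ∖{0}}(w) for all w ∈ ℂ∖{0}. -/

import Mathlib

open Complex Set Metric
open scoped ENNReal

noncomputable section

/-- The open unit disk in the complex plane. -/
def unitDisk : Set ℂ := Metric.ball (0 : ℂ) 1

/-- A plane domain: a nonempty open connected subset of ℂ. -/
def IsPlaneDomain (S : Set ℂ) : Prop := IsOpen S ∧ IsConnected S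

/-- The Hurwitz radius `r_Ω(w)`: the supremum of `h'(0)` over all holomorphic
`h : 𝔻 → Ω` with `h 0 = w`, `h t ≠ w` for `t ∈ 𝔻 \ {0}`, and `h'(0) > 0` (real). -/
def hurwitzRadius (Ω : Set ℂ) (w : ℂ) : ℝ :=
  sSup { r : ℝ | 0 < r ∧ ∃ h : ℂ → ℂ, DifferentiableOn ℂ h unitDisk ∧
    Set.MapsTo h unitDisk Ω ∧ h 0 = w ∧ (∀ t ∈ unitDisk, t ≠ 0 → h t ≠ w) ∧
    deriv h 0 = (r : ℂ) }

/-- The Hurwitz density `η_Ω(w) = 2 / r_Ω(w)`. -/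
def hurwitzDensity (Ω : Set ℂ) (w : ℂ) : ℝ := 2 / hurwitzRadius Ω w

/-- A (C¹, hence rectifiable) path in `Ω` from `w₁` to `w₂`, parametrized on `[0,1]`. -/
def IsPathIn (Ω : Set ℂ) (w₁ w₂ : ℂ) (γ : ℝ → ℂ) : Prop :=
  γ 0 = w₁ ∧ γ 1 = w₂ ∧ (∀ t ∈ Set.Icc (0:ℝ) 1, γ t ∈ Ω) ∧
    ContDiffOn ℝ 1 γ (Set.Icc (0:ℝ) 1)

/-- The Hurwitz distance: infimum of Hurwitz lengths of rectifiable paths in `Ω`. -/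
def hurwitzDist (Ω : Set ℂ) (w₁ w₂ : ℂ) : ℝ :=
  sInf { L : ℝ | ∃ γ : ℝ → ℂ, IsPathIn Ω w₁ w₂ γ ∧
    L = ∫ t in (0:ℝ)..1, hurwitzDensity Ω (γ t) * ‖derivWithin γ (Set.Icc (0:ℝ) 1) t‖ }

/-- The generalized Hurwitz density `η_Ω^Y(w)` with basepoint domain `Y`
(`+∞` if no admissible map exists). -/
def genHurwitzDensity (Y Ω : Set ℂ) (w : ℂ) : ℝ≥0∞ :=
  sInf { x : ℝ≥0∞ | ∃ s ∈ Y, ∃ h : ℂ → ℂ, DifferentiableOn ℂ h Y ∧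
    Set.MapsTo h Y Ω ∧ h s = w ∧ (∀ t ∈ Y, t ≠ s → h t ≠ w) ∧ deriv h s ≠ 0 ∧
    x = ENNReal.ofReal (hurwitzDensity Y s / ‖deriv h s‖) }

/-- The generalized Hurwitz distance `η_Ω^Y(z₁,z₂)`. -/
def genHurwitzDist (Y Ω : Set ℂ) (z₁ z₂ : ℂ) : ℝ≥0∞ :=
  sInf { L : ℝ≥0∞ | ∃ γ : ℝ → ℂ, IsPathIn Ω z₁ z₂ γ ∧
    L = ∫⁻ t in Set.Icc (0:ℝ) 1,
      genHurwitzDensity Y Ω (γ t) * ENNReal.ofReal ‖derivWithin γ (Set.Icc (0:ℝ) 1) t‖ }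

/-- The infinitesimal contraction constant `l_η(Ω, Y)`. -/
def lEta (Ω Y : Set ℂ) : ℝ :=
  sSup { x : ℝ | ∃ w ∈ Ω, x = hurwitzDensity Y w / hurwitzDensity Ω w }

/-- The global contraction constant `gl_η(Ω, Y)`. -/
def glEta (Ω Y : Set ℂ) : ℝ :=
  sSup { x : ℝ | ∃ w₁ ∈ Ω, ∃ w₂ ∈ Ω, w₁ ≠ w₂ ∧
    x = hurwitzDist Y w₁ w₂ / hurwitzDist Ω w₁ w₂ }

open Filter Topology ComplexConjugate

/-- The admissible derivatives in the definition of the Hurwitz radius. -/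
def hurwitzSet (Ω : Set ℂ) (w : ℂ) : Set ℝ :=
  { r : ℝ | 0 < r ∧ ∃ h : ℂ → ℂ, DifferentiableOn ℂ h unitDisk ∧
    Set.MapsTo h unitDisk Ω ∧ h 0 = w ∧ (∀ t ∈ unitDisk, t ≠ 0 → h t ≠ w) ∧
    deriv h 0 = (r : ℂ) }

lemma hurwitzRadius_eq_sSup (Ω : Set ℂ) (w : ℂ) : hurwitzRadius Ω w = sSup (hurwitzSet Ω w) := rfl

lemma mem_unitDisk {z : ℂ} : z ∈ unitDisk ↔ ‖z‖ < 1 := by simp [unitDisk]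

lemma isOpen_unitDisk : IsOpen unitDisk := Metric.isOpen_ball

lemma one_add_conj_mul_ne_zero {s a : ℂ} (hs : ‖s‖ < 1) (ha : ‖a‖ < 1) :
    1 + conj s * a ≠ 0 := by
  intro h
  have h1 : conj s * a = -1 := by linear_combination h
  have h2 : ‖s‖ * ‖a‖ = 1 := by
    have := congrArg norm h1
    simpa using this
  nlinarith [norm_nonneg s, norm_nonneg a]

lemma norm_mobius_lt_one {s a : ℂ} (hs : ‖s‖ < 1) (ha : ‖a‖ < 1) :
    ‖(a + s) / (1 + conj s * a)‖ < 1 := by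
  have h0 := one_add_conj_mul_ne_zero hs ha
  rw [norm_div, div_lt_one (norm_pos_iff.2 h0)]
  apply lt_of_pow_lt_pow_left₀ 2 (norm_nonneg _)
  have key : ‖1 + conj s * a‖ ^ 2 - ‖a + s‖ ^ 2 = (1 - ‖s‖ ^ 2) * (1 - ‖a‖ ^ 2) := by
    simp only [← Complex.normSq_eq_norm_sq, Complex.normSq_apply, Complex.add_re, Complex.add_im,
      Complex.mul_re, Complex.mul_im, Complex.conj_re, Complex.conj_im, Complex.one_re,
      Complex.one_im]
    ring
  have h1 : 0 < 1 - ‖s‖ ^ 2 := by nlinarith [norm_nonneg s]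
  have h2 : 0 < 1 - ‖a‖ ^ 2 := by nlinarith [norm_nonneg a]
  nlinarith [mul_pos h1 h2]

lemma one_sub_norm_sq_ne_zero {s : ℂ} (hs : ‖s‖ < 1) : (1 : ℂ) - conj s * s ≠ 0 := by
  have := one_add_conj_mul_ne_zero hs (a := -s) (by simpa using hs)
  simpa [sub_eq_add_neg] using this

/-- Scaling by `‖s‖` and then moving `0` to `s` gives a competitor for the punctured disk. -/
lemma mem_hurwitzSet_puncturedDisk {s : ℂ} (hs : ‖s‖ < 1) (hs0 : s ≠ 0) :
    ‖s‖ * (1 - ‖s‖ ^ 2) ∈ hurwitzSet (unitDisk \ {0}) s := by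
  have hp : 0 < ‖s‖ := norm_pos_iff.2 hs0
  have hscale : ∀ z ∈ unitDisk, ‖(‖s‖ : ℂ) * z‖ < ‖s‖ := fun z hz => by
    rw [mem_unitDisk] at hz
    rw [norm_mul, Complex.norm_real, norm_norm]
    nlinarith
  have hden : ∀ z ∈ unitDisk, 1 + conj s * ((‖s‖ : ℂ) * z) ≠ 0 := fun z hz =>
    one_add_conj_mul_ne_zero hs ((hscale z hz).trans hs)
  refine ⟨by have : 0 < 1 - ‖s‖ ^ 2 := by nlinarith
             positivity,
    fun z => ((‖s‖ : ℂ) * z + s) / (1 + conj s * ((‖s‖ : ℂ) * z)), ?_, ?_, by simp, ?_, ?_⟩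
  · exact DifferentiableOn.div (by fun_prop) (by fun_prop) hden
  · intro z hz
    refine ⟨mem_unitDisk.2 (norm_mobius_lt_one hs ((hscale z hz).trans hs)), ?_⟩
    simp only [mem_singleton_iff, div_eq_zero_iff, hden z hz, or_false]
    intro h
    have h1 : (‖s‖ : ℂ) * z = -s := by linear_combination h
    have h2 := hscale z hz
    rw [h1, norm_neg] at h2
    exact lt_irrefl _ h2
  · intro z hz hz0 h
    rw [div_eq_iff (hden z hz)] at h
    have h1 : (‖s‖ : ℂ) * z * (1 - conj s * s) = 0 := by linear_combination h
    simp [hs0, hz0, one_sub_norm_sq_ne_zero hs] at h1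
  · have hnum : HasDerivAt (fun z : ℂ => (‖s‖ : ℂ) * z + s) (‖s‖ : ℂ) 0 := by
      simpa using ((hasDerivAt_id (0 : ℂ)).const_mul (‖s‖ : ℂ)).add_const s
    have hd : HasDerivAt (fun z : ℂ => 1 + conj s * ((‖s‖ : ℂ) * z)) (conj s * (‖s‖ : ℂ)) 0 := by
      simpa using (((hasDerivAt_id (0 : ℂ)).const_mul (‖s‖ : ℂ)).const_mul (conj s)).const_add 1
    have := hnum.div hd (by simp)
    have h2 := this.deriv
    simp only [mul_zero, add_zero, zero_add, one_pow, div_one, mul_one] at h2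
    have h3 : s * conj s = ((‖s‖ : ℂ)) ^ 2 := Complex.mul_conj' s
    refine Eq.trans h2 ?_
    push_cast
    linear_combination (-(‖s‖ : ℂ)) * h3

lemma bddAbove_hurwitzSet_puncturedDisk (s : ℂ) : BddAbove (hurwitzSet (unitDisk \ {0}) s) := by
  refine ⟨2, ?_⟩
  rintro r ⟨hr, g, hg, hm, h0, -, hd⟩
  have h := Complex.norm_deriv_le_div_of_mapsTo_ball (f := g) (c := 0) (R₁ := 1) (R₂ := 2) hg
    (fun z hz => ?_) one_pos
  · rw [hd, Complex.norm_real, Real.norm_of_nonneg hr.le] at h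
    simpa using h
  · have h1 := mem_unitDisk.1 (hm hz).1
    have h2 := mem_unitDisk.1 (hm (show (0 : ℂ) ∈ unitDisk by simp [unitDisk])).1
    rw [Metric.mem_closedBall, dist_eq_norm]
    have := norm_sub_le (g z) (g 0)
    linarith

/-- Composition, after a rotation, of a competitor with an admissible map. -/
lemma norm_deriv_mul_mem_hurwitzSet {Y Ω : Set ℂ} {s w : ℂ} {h : ℂ → ℂ} (hY : IsOpen Y)
    (hs : s ∈ Y) (hh : DifferentiableOn ℂ h Y) (hm : MapsTo h Y Ω) (hsw : h s = w)
    (hne : ∀ t ∈ Y, t ≠ s → h t ≠ w) (hd : deriv h s ≠ 0) {r : ℝ} (hr : r ∈ hurwitzSet Y s) :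
    ‖deriv h s‖ * r ∈ hurwitzSet Ω w := by
  obtain ⟨hr0, g, hg, hgm, hg0, hgne, hgd⟩ := hr
  have hdp : 0 < ‖deriv h s‖ := norm_pos_iff.2 hd
  set u : ℂ := (‖deriv h s‖ : ℂ) / deriv h s with hu
  have hun : ‖u‖ = 1 := by
    rw [hu, norm_div, Complex.norm_real, norm_norm, div_self hdp.ne']
  have hu0 : u ≠ 0 := by rw [← norm_pos_iff, hun]; exact one_pos
  have hrot : MapsTo (fun z => u * z) unitDisk unitDisk := fun z hz => by
    rw [mem_unitDisk] at hz ⊢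
    rwa [norm_mul, hun, one_mul]
  refine ⟨mul_pos hdp hr0, fun z => h (g (u * z)), ?_, ?_, by simp [hg0, hsw], ?_, ?_⟩
  · exact hh.comp (hg.comp (by fun_prop) hrot) (hgm.comp hrot)
  · exact hm.comp (hgm.comp hrot)
  · intro t ht ht0
    exact hne _ (hgm (hrot ht)) (hgne _ (hrot ht) (mul_ne_zero hu0 ht0))
  · have h1 : HasDerivAt (fun z => u * z) u 0 := by
      simpa using (hasDerivAt_id (0 : ℂ)).const_mul u
    have h2 : HasDerivAt g r (u * 0) := by
      rw [mul_zero, ← hgd]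
      exact (hg.differentiableAt (isOpen_unitDisk.mem_nhds (by simp [unitDisk]))).hasDerivAt
    have h3 : HasDerivAt h (deriv h s) (g (u * 0)) := by
      rw [mul_zero, hg0]
      exact (hh.differentiableAt (hY.mem_nhds hs)).hasDerivAt
    refine (h3.comp (0 : ℂ) (HasDerivAt.comp (0 : ℂ) h2 h1)).deriv.trans ?_
    rw [hu]
    push_cast
    field_simp

lemma ofReal_hurwitzDensity_le_genHurwitzDensity {Y Ω : Set ℂ} {w : ℂ} (hY : IsOpen Y)
    (hne : ∀ s ∈ Y, (hurwitzSet Y s).Nonempty) :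
    ENNReal.ofReal (hurwitzDensity Ω w) ≤ genHurwitzDensity Y Ω w := by
  refine le_sInf ?_
  rintro x ⟨s, hs, h, hh, hm, hsw, hinj, hd, rfl⟩
  apply ENNReal.ofReal_le_ofReal
  have hdp : 0 < ‖deriv h s‖ := norm_pos_iff.2 hd
  have hYnn : 0 ≤ sSup (hurwitzSet Y s) := Real.sSup_nonneg fun r hr => hr.1.le
  simp only [hurwitzDensity, hurwitzRadius_eq_sSup]
  by_cases hb : BddAbove (hurwitzSet Ω w)
  · have hle : ∀ r ∈ hurwitzSet Y s, r ≤ sSup (hurwitzSet Ω w) / ‖deriv h s‖ := fun r hr => by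
      rw [le_div_iff₀ hdp, mul_comm]
      exact le_csSup hb (norm_deriv_mul_mem_hurwitzSet hY hs hh hm hsw hinj hd hr)
    obtain ⟨r, hr⟩ := hne s hs
    have hpos : 0 < sSup (hurwitzSet Y s) := hr.1.trans_le (le_csSup ⟨_, hle⟩ hr)
    have hsup := csSup_le (hne s hs) hle
    rw [le_div_iff₀ hdp] at hsup
    rw [div_div]
    exact div_le_div_of_nonneg_left zero_le_two (mul_pos hpos hdp) hsup
  · rw [Real.sSup_of_not_bddAbove hb]
    simp only [div_zero]
    positivity

/-- Precomposing a competitor for `Ω` with a disk automorphism sending `s` to `0`. -/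
lemma genHurwitzDensity_puncturedDisk_le_div_mul {Ω : Set ℂ} {w : ℂ} {r : ℝ}
    (hr : r ∈ hurwitzSet Ω w) {s : ℂ} (hs : ‖s‖ < 1) (hs0 : s ≠ 0) :
    genHurwitzDensity (unitDisk \ {0}) Ω w ≤ ENNReal.ofReal (2 / (r * ‖s‖)) := by
  obtain ⟨hr0, f, hf, hfm, hf0, hfne, hfd⟩ := hr
  have hp : 0 < ‖s‖ := norm_pos_iff.2 hs0
  have hq : 0 < 1 - ‖s‖ ^ 2 := by nlinarith
  have hns : ‖-s‖ < 1 := by rwa [norm_neg]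
  let φ : ℂ → ℂ := fun z => (z + -s) / (1 + conj (-s) * z)
  have hden : ∀ z ∈ unitDisk, 1 + conj (-s) * z ≠ 0 := fun z hz =>
    one_add_conj_mul_ne_zero hns (mem_unitDisk.1 hz)
  have hφ : DifferentiableOn ℂ φ unitDisk :=
    DifferentiableOn.div (by fun_prop) (by fun_prop) hden
  have hφm : MapsTo φ unitDisk unitDisk := fun z hz =>
    mem_unitDisk.2 (norm_mobius_lt_one hns (mem_unitDisk.1 hz))
  have hφs : φ s = 0 := by simp [φ]
  have hconj : conj s * s = (‖s‖ : ℂ) ^ 2 := by rw [mul_comm]; exact Complex.mul_conj' s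
  have hφd : HasDerivAt φ (1 / ((1 - ‖s‖ ^ 2 : ℝ) : ℂ)) s := by
    have hn : HasDerivAt (fun z : ℂ => z + -s) 1 s := (hasDerivAt_id s).add_const (-s)
    have hd : HasDerivAt (fun z : ℂ => 1 + conj (-s) * z) (conj (-s)) s := by
      simpa using ((hasDerivAt_id s).const_mul (conj (-s))).const_add 1
    have h0 := hden s (mem_unitDisk.2 hs)
    have he : 1 + conj (-s) * s = ((1 - ‖s‖ ^ 2 : ℝ) : ℂ) := by
      push_cast
      rw [map_neg]
      linear_combination -hconj
    refine (hn.div hd h0).congr_deriv ?_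
    rw [← he, add_neg_cancel, zero_mul, sub_zero, one_mul, sq, div_mul_cancel_left₀ h0, one_div]
  have hcomp : HasDerivAt (f ∘ φ) ((r / (1 - ‖s‖ ^ 2) : ℝ) : ℂ) s := by
    have h1 : HasDerivAt f r (φ s) := by
      rw [hφs, ← hfd]
      exact (hf.differentiableAt (isOpen_unitDisk.mem_nhds (by simp [unitDisk]))).hasDerivAt
    refine (h1.comp s hφd).congr_deriv ?_
    push_cast
    ring
  have hnorm : ‖deriv (f ∘ φ) s‖ = r / (1 - ‖s‖ ^ 2) := by
    rw [hcomp.deriv, Complex.norm_real, Real.norm_of_nonneg (by positivity)]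
  have hmem : ENNReal.ofReal (hurwitzDensity (unitDisk \ {0}) s / ‖deriv (f ∘ φ) s‖) ∈
      { x : ℝ≥0∞ | ∃ s ∈ unitDisk \ {0}, ∃ h : ℂ → ℂ, DifferentiableOn ℂ h (unitDisk \ {0}) ∧
        Set.MapsTo h (unitDisk \ {0}) Ω ∧ h s = w ∧ (∀ t ∈ unitDisk \ {0}, t ≠ s → h t ≠ w) ∧
        deriv h s ≠ 0 ∧
        x = ENNReal.ofReal (hurwitzDensity (unitDisk \ {0}) s / ‖deriv h s‖) } := by
    refine ⟨s, ⟨mem_unitDisk.2 hs, hs0⟩, f ∘ φ, (hf.comp hφ hφm).mono sdiff_subset,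
      (hfm.comp hφm).mono_left sdiff_subset, by simp [hφs, hf0], ?_, ?_, rfl⟩
    · intro t ht hts
      refine hfne _ (hφm ht.1) (div_ne_zero ?_ (hden t ht.1))
      rwa [← sub_eq_add_neg, sub_ne_zero]
    · rw [← norm_pos_iff, hnorm]
      positivity
  refine (sInf_le hmem).trans (ENNReal.ofReal_le_ofReal ?_)
  have hrad : ‖s‖ * (1 - ‖s‖ ^ 2) ≤ hurwitzRadius (unitDisk \ {0}) s :=
    le_csSup (bddAbove_hurwitzSet_puncturedDisk s) (mem_hurwitzSet_puncturedDisk hs hs0)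
  rw [hnorm, hurwitzDensity, div_div]
  refine div_le_div_of_nonneg_left zero_le_two (by positivity) ?_
  calc r * ‖s‖ = ‖s‖ * (1 - ‖s‖ ^ 2) * (r / (1 - ‖s‖ ^ 2)) := by field_simp
    _ ≤ _ := by gcongr

lemma genHurwitzDensity_puncturedDisk_le_div {Ω : Set ℂ} {w : ℂ} {r : ℝ}
    (hr : r ∈ hurwitzSet Ω w) :
    genHurwitzDensity (unitDisk \ {0}) Ω w ≤ ENNReal.ofReal (2 / r) := by
  have hr0 : r ≠ 0 := hr.1.ne'
  have hlim : Tendsto (fun x : ℝ => ENNReal.ofReal (2 / (r * x))) (𝓝[<] 1)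
      (𝓝 (ENNReal.ofReal (2 / r))) := by
    have hc : ContinuousAt (fun x : ℝ => 2 / (r * x)) 1 :=
      ContinuousAt.div (by fun_prop) (by fun_prop) (by simpa using hr0)
    have h := (ENNReal.tendsto_ofReal hc.tendsto).mono_left (nhdsWithin_le_nhds (s := Iio 1))
    simpa using h
  refine ge_of_tendsto hlim ?_
  filter_upwards [Ioo_mem_nhdsLT (zero_lt_one' ℝ)] with x hx
  have hn : ‖(x : ℂ)‖ = x := by rw [Complex.norm_real, Real.norm_of_nonneg hx.1.le]
  have h := genHurwitzDensity_puncturedDisk_le_div_mul hr (s := (x : ℂ)) (by rw [hn]; exact hx.2)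
    (by exact_mod_cast hx.1.ne')
  rwa [hn] at h

/-- With the punctured disk as basepoint domain, the generalized Hurwitz density agrees with the
Hurwitz density wherever there is a competitor for the latter. -/
lemma genHurwitzDensity_puncturedDisk {Ω : Set ℂ} {w : ℂ} (hne : (hurwitzSet Ω w).Nonempty) :
    genHurwitzDensity (unitDisk \ {0}) Ω w = ENNReal.ofReal (hurwitzDensity Ω w) := by
  refine le_antisymm ?_ (ofReal_hurwitzDensity_le_genHurwitzDensity
    (isOpen_unitDisk.sdiff isClosed_singleton)
    fun s hs => ⟨_, mem_hurwitzSet_puncturedDisk (mem_unitDisk.1 hs.1) hs.2⟩)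
  rw [hurwitzDensity, hurwitzRadius_eq_sSup]
  by_cases hb : BddAbove (hurwitzSet Ω w)
  · obtain ⟨r, hr⟩ := hne
    have hpos : 0 < sSup (hurwitzSet Ω w) := hr.1.trans_le (le_csSup hb hr)
    obtain ⟨v, -, hv, hvm⟩ := exists_seq_tendsto_sSup ⟨r, hr⟩ hb
    exact ge_of_tendsto' (ENNReal.tendsto_ofReal (tendsto_const_nhds.div hv hpos.ne'))
      fun n => genHurwitzDensity_puncturedDisk_le_div (hvm n)
  · rw [Real.sSup_of_not_bddAbove hb, div_zero]
    have hlim : Tendsto (fun n : ℕ => ENNReal.ofReal (2 / ((n : ℝ) + 1))) atTop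
        (𝓝 (ENNReal.ofReal 0)) :=
      ENNReal.tendsto_ofReal
        ((tendsto_natCast_atTop_atTop.atTop_add tendsto_const_nhds).const_div_atTop 2)
    refine ge_of_tendsto' hlim fun n => ?_
    obtain ⟨r, hr, hnr⟩ := not_bddAbove_iff.1 hb ((n : ℝ) + 1)
    exact (genHurwitzDensity_puncturedDisk_le_div hr).trans (ENNReal.ofReal_le_ofReal
      (div_le_div_of_nonneg_left zero_le_two (by positivity) hnr.le))

lemma norm_mem_hurwitzSet_puncturedPlane {w : ℂ} (hw : w ≠ 0) :
    ‖w‖ ∈ hurwitzSet {(0 : ℂ)}ᶜ w := by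
  have hp : 0 < ‖w‖ := norm_pos_iff.2 hw
  refine ⟨hp, fun z => (‖w‖ : ℂ) * z + w, by fun_prop, ?_, by simp, ?_, ?_⟩
  · intro z hz h
    have h1 : (‖w‖ : ℂ) * z = -w := eq_neg_of_add_eq_zero_left h
    have h2 := congrArg norm h1
    rw [norm_mul, Complex.norm_real, norm_norm, norm_neg] at h2
    have := mem_unitDisk.1 hz
    nlinarith
  · intro t _ ht0 h
    simp [hw, ht0] at h
  · simp

/-- for the punctured disk as basepoint domain and the punctured
plane as target, the generalized and ordinary Hurwitz densities coincide. -/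
theorem genHurwitz_punctured_disk_punctured_plane (w : ℂ) (hw : w ≠ 0) :
    genHurwitzDensity (unitDisk \ {0}) {(0 : ℂ)}ᶜ w
      = ENNReal.ofReal (hurwitzDensity {(0 : ℂ)}ᶜ w) :=
  genHurwitzDensity_puncturedDisk ⟨_, norm_mem_hurwitzSet_puncturedPlane hw⟩
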